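/- Let (A, Φ, φ) be a C*-dynamical system and Ψ : A → A a unital completely positive map with Φ(Ψ(a)) = a for all a ∈ A. Then Ψ is a φ-adjoint of Φ, i.e. φ(aΨ(b)) = φ(Φ(a)b) for all a, b ∈ A. -/

import Mathlib

open scoped ComplexOrder

/-- Complete positivity of a linear map between star-ordered `ℂ`-algebras. -/
def IsCompletelyPositive {A B : Type*} [Ring A] [StarRing A] [Algebra ℂ A]
    [Ring B] [StarRing B] [PartialOrder B] [Algebra ℂ B]
    (Φ : A →ₗ[ℂ] B) : Prop :=
  ∀ (n : ℕ) (a : Fin n → A) (c : Fin n → B),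
    0 ≤ ∑ i : Fin n, ∑ j : Fin n, star (c i) * Φ (star (a i) * a j) * c j

namespace IsCompletelyPositive

variable {A B : Type*} [Ring A] [StarRing A] [Algebra ℂ A]
  [Ring B] [StarRing B] [PartialOrder B] [Algebra ℂ B] {Φ : A →ₗ[ℂ] B}

lemma map_star_mul_self_nonneg (h : IsCompletelyPositive Φ) (x : A) : 0 ≤ Φ (star x * x) := by
  simpa using h 1 ![x] ![1]

lemma isSelfAdjoint_map_star_add [StarOrderedRing B] (h : IsCompletelyPositive Φ) (x : A) :
    IsSelfAdjoint (Φ (star x) + Φ x) := by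
  have hsum : Φ (star x) + Φ x =
      Φ (star (x + 1) * (x + 1)) - Φ (star x * x) - Φ (star 1 * 1) := by
    simp only [star_add, star_one, mul_add, add_mul, one_mul, mul_one, map_add]
    abel
  rw [hsum]
  exact ((h.map_star_mul_self_nonneg _).isSelfAdjoint.sub
    (h.map_star_mul_self_nonneg _).isSelfAdjoint).sub (h.map_star_mul_self_nonneg _).isSelfAdjoint

/-- A completely positive map on a unital algebra preserves the star operation. -/
lemma map_star [StarModule ℂ A] [StarOrderedRing B] [StarModule ℂ B]
    (h : IsCompletelyPositive Φ) (x : A) : Φ (star x) = star (Φ x) := by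
  have h₁ := (h.isSelfAdjoint_map_star_add x).star_eq
  have h₂ := (h.isSelfAdjoint_map_star_add (Complex.I • x)).star_eq
  simp only [star_add, star_smul, map_smul, Complex.star_def, Complex.conj_I,
    neg_smul, map_neg, star_neg, neg_neg] at h₁ h₂
  have h₃ := congrArg (Complex.I • ·) h₂
  simp only [smul_add, smul_neg, smul_smul, Complex.I_mul_I, neg_smul, one_smul, neg_neg] at h₃
  have h₄ : (2 : ℂ) • Φ (star x) = (2 : ℂ) • star (Φ x) := by
    rw [two_smul, two_smul]
    linear_combination (norm := module) - h₁ - h₃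
  exact smul_right_injective B (two_ne_zero (α := ℂ)) h₄

/-- The Kadison–Schwarz inequality. -/
lemma star_map_mul_map_le [StarModule ℂ A] [StarOrderedRing B] [StarModule ℂ B]
    (h : IsCompletelyPositive Φ) (h1 : Φ 1 = 1) (x : A) :
    star (Φ x) * Φ x ≤ Φ (star x * x) := by
  have := h 2 ![x, 1] ![1, -Φ x]
  simpa [Fin.sum_univ_two, h1, h.map_star] using this

end IsCompletelyPositive

lemma LinearMap.map_nonneg_of_star_mul_self {A : Type*} [Ring A] [StarRing A] [PartialOrder A]
    [StarOrderedRing A] [Algebra ℂ A] {φ : A →ₗ[ℂ] ℂ} (hφ : ∀ a : A, 0 ≤ φ (star a * a))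
    {a : A} (ha : 0 ≤ a) : 0 ≤ φ a := by
  rw [StarOrderedRing.nonneg_iff] at ha
  induction ha using AddSubmonoid.closure_induction with
  | mem x hx =>
    obtain ⟨s, rfl⟩ := hx
    exact hφ s
  | zero => simp
  | add x y _ _ hx hy =>
    rw [map_add]
    exact add_nonneg hx hy

lemma Real.eq_zero_of_forall_add_mul_nonneg {p r : ℝ} (h : ∀ s : ℝ, 0 ≤ p + s * r) : r = 0 := by
  by_contra hr
  have := h (-(p + 1) / r)
  rw [div_mul_cancel₀ _ hr] at this
  linarith

lemma Complex.eq_zero_of_forall_add_mul_nonneg {p r : ℂ} (h : ∀ s : ℝ, 0 ≤ p + s * r) :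
    r = 0 := by
  have him (s : ℝ) : 0 = p.im + s * r.im := by simpa using (Complex.nonneg_iff.mp (h s)).2
  apply Complex.ext
  · exact Real.eq_zero_of_forall_add_mul_nonneg (p := p.re) fun s ↦ by
      simpa using (Complex.nonneg_iff.mp (h s)).1
  · exact Real.eq_zero_of_forall_add_mul_nonneg fun s ↦ (him s).le

/-- A null vector of a positive semidefinite sesquilinear form is orthogonal to every vector. -/
lemma Complex.eq_zero_of_forall_add_mul_add_conj_mul_nonneg {p w v : ℂ}
    (h : ∀ t : ℂ, 0 ≤ p + t * w + star t * v) : w = 0 := by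
  have h₁ : w + v = 0 := Complex.eq_zero_of_forall_add_mul_nonneg (p := p) fun s ↦ by
    have := h s
    rw [Complex.star_def, Complex.conj_ofReal] at this
    convert this using 1
    ring
  have h₂ : Complex.I * (w - v) = 0 := Complex.eq_zero_of_forall_add_mul_nonneg (p := p) fun s ↦ by
    have := h (s * Complex.I)
    rw [Complex.star_def, map_mul, Complex.conj_ofReal, Complex.conj_I] at this
    convert this using 1
    ring
  have h₃ : w - v = 0 := (mul_eq_zero.mp h₂).resolve_left Complex.I_ne_zero
  linear_combination (h₁ + h₃) / 2

/-- if `(A, Φ, φ)` is a C*-dynamical system and `Ψ` is a unital completely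
positive right inverse of `Φ`, then `Ψ` is a `φ`-adjoint of `Φ`:
`φ(aΨ(b)) = φ(Φ(a)b)` for all `a, b ∈ A`. -/
theorem statement11 {A : Type*} [NormedRing A] [StarRing A] [CStarRing A]
    [PartialOrder A] [StarOrderedRing A] [NormedAlgebra ℂ A] [StarModule ℂ A]
    [CompleteSpace A]
    (φ : A →ₗ[ℂ] ℂ) (hφ1 : φ 1 = 1) (hφpos : ∀ a : A, 0 ≤ φ (star a * a))
    (Φ : A →ₗ[ℂ] A) (hΦ1 : Φ 1 = 1) (hΦcp : IsCompletelyPositive Φ)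
    (hinv : ∀ a, φ (Φ a) = φ a)
    (Ψ : A →ₗ[ℂ] A) (hΨ1 : Ψ 1 = 1) (hΨcp : IsCompletelyPositive Ψ)
    (hΦΨ : ∀ a : A, Φ (Ψ a) = a) :
    ∀ a b : A, φ (a * Ψ b) = φ (Φ a * b) := by
  have hmono {x y : A} (hxy : x ≤ y) : φ x ≤ φ y := by
    have := LinearMap.map_nonneg_of_star_mul_self hφpos (sub_nonneg.mpr hxy)
    rwa [map_sub, sub_nonneg] at this
  intro a b
  have hnull : φ (star (Ψ b) * Ψ b) = φ (star b * b) := by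
    apply le_antisymm
    · calc φ (star (Ψ b) * Ψ b) ≤ φ (Ψ (star b * b)) := hmono (hΨcp.star_map_mul_map_le hΨ1 b)
        _ = φ (star b * b) := by rw [← hinv, hΦΨ]
    · calc φ (star b * b) ≤ φ (Φ (star (Ψ b) * Ψ b)) :=
            hmono (by simpa only [hΦΨ] using hΦcp.star_map_mul_map_le hΦ1 (Ψ b))
        _ = φ (star (Ψ b) * Ψ b) := hinv _
  have hzero : φ (a * Ψ b) - φ (Φ a * b) = 0 := by
    apply Complex.eq_zero_of_forall_add_mul_add_conj_mul_nonneg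
      (p := φ (a * star a) - φ (Φ a * star (Φ a)))
      (v := φ (star (Ψ b) * star a) - φ (star b * star (Φ a)))
    intro t
    have key := sub_nonneg.mpr (hmono (hΦcp.star_map_mul_map_le hΦ1 (star a + t • Ψ b)))
    rw [hinv] at key
    convert key using 1
    simp only [map_add, map_smul, hΦΨ, hΦcp.map_star, star_add, star_smul, star_star, mul_add,
      add_mul, smul_mul_assoc, mul_smul_comm, smul_eq_mul, hnull]
    ring
  exact sub_eq_zero.mp hzero
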